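/- There is an absolute constant C such that the following holds for every integer n ≥ 2. Let (X_k⁽¹⁾)_{k=1}^n and (X_k⁽²⁾)_{k=1}^n be two independent random vectors, each uniformly distributed on the simplex Δ_{n−1}, and let (λ_k⁽¹⁾)_{k=1}^n and (λ_k⁽²⁾)_{k=1}^n denote their decreasing rearrangements. Then the probability that λ_k⁽¹⁾ + … + λ_n⁽¹⁾ ≤ λ_k⁽²⁾ + … + λ_n⁽²⁾ holds for all 1 ≤ k ≤ n is at most C·(n/log n)^{−1/16}. -/

import Mathlib

open MeasureTheory ProbabilityTheory Filter Topology

noncomputable section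

/-- The decreasing rearrangement of a tuple of reals. -/
def sortDesc {n : ℕ} (v : Fin n → ℝ) : Fin n → ℝ :=
  fun i => v (Tuple.sort v i.rev)

/-- `tailSum v k = v k + v (k+1) + ... + v (n-1)` (so with `v` sorted decreasingly and
`k` the 0-indexed version of the 1-indexed index in the paper, this is `λ_k + ... + λ_n`). -/
def tailSum {n : ℕ} (v : Fin n → ℝ) (k : Fin n) : ℝ :=
  ∑ i ∈ Finset.univ.filter (fun i => k ≤ i), v i

/-- The uniform probability measure on the simplex `Δ_{n−1}`, realised as the law of
`(Z₁, …, Z_n)/(Z₁ + … + Z_n)` for i.i.d. mean-1 exponential random variables `Z₁, …, Z_n`. -/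
def simplexUniform (n : ℕ) : Measure (Fin n → ℝ) :=
  (Measure.pi fun _ : Fin n => expMeasure 1).map fun Z i => Z i / ∑ j, Z j

open scoped ENNReal

/-- Tonelli's theorem for a product of functions of one coordinate each. -/
theorem lintegral_pi_prod_eq_prod {n : ℕ} (μ : Fin n → Measure ℝ) [∀ i, SigmaFinite (μ i)]
    (f : Fin n → ℝ → ℝ≥0∞) (hf : ∀ i, Measurable (f i)) :
    ∫⁻ x, ∏ i, f i (x i) ∂(Measure.pi μ) = ∏ i, ∫⁻ y, f i y ∂(μ i) := by
  induction n with
  | zero => simp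
  | succ n ih =>
    rw [← (measurePreserving_piFinSuccAbove μ 0).symm.lintegral_comp_emb
      (MeasurableEquiv.measurableEmbedding _), Fin.prod_univ_succ,
      ← ih (fun i => μ i.succ) (fun i => f i.succ) (fun i => hf _), ← lintegral_prod_mul]
    · refine lintegral_congr fun z => ?_
      simp [Fin.prod_univ_succ, MeasurableEquiv.piFinSuccAbove, Fin.insertNthEquiv]
    · exact (hf 0).aemeasurable
    · exact (Finset.measurable_prod _ fun i _ =>
        (hf i.succ).comp (measurable_pi_apply i)).aemeasurable

/-- A product of measures with densities has the product density. -/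
theorem pi_withDensity_eq {n : ℕ} (μ : Fin n → Measure ℝ) [∀ i, SigmaFinite (μ i)]
    (f : Fin n → ℝ → ℝ≥0∞) (hf : ∀ i, Measurable (f i))
    [∀ i, SigmaFinite ((μ i).withDensity (f i))] :
    Measure.pi (fun i => (μ i).withDensity (f i)) =
      (Measure.pi μ).withDensity fun x => ∏ i, f i (x i) := by
  refine Measure.pi_eq fun s hs => ?_
  rw [withDensity_apply _ (.univ_pi hs), Measure.restrict_pi_pi, lintegral_pi_prod_eq_prod _ _ hf]
  exact Finset.prod_congr rfl fun i _ => (withDensity_apply _ (hs i)).symm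

/-- Coordinatewise domination of measures gives domination of the product measures. -/
theorem pi_le_smul_pi {n : ℕ} (μ ν : Fin n → Measure ℝ) [∀ i, SigmaFinite (μ i)]
    [∀ i, SigmaFinite (ν i)] (K : ℝ≥0∞) (h : ∀ i, μ i ≤ K • ν i) :
    Measure.pi μ ≤ K ^ n • Measure.pi ν := by
  induction n with
  | zero => simp [Subsingleton.elim μ ν]
  | succ n ih =>
    rw [← (measurePreserving_piFinSuccAbove μ 0).symm.map_eq,
      ← (measurePreserving_piFinSuccAbove ν 0).symm.map_eq, ← Measure.map_smul]
    refine Measure.map_mono ?_ (MeasurableEquiv.measurable _)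
    refine (Measure.prod_mono (h 0) (ih (fun j => μ j.succ) (fun j => ν j.succ)
      fun i => h _)).trans ?_
    rw [Measure.prod_smul_left, Measure.prod_smul_right, smul_smul, pow_succ']
    rfl

/-- Restricting a product of probability measures to a subfamily of the coordinates. -/
theorem map_pi_comp_injective {m n : ℕ} (μ : Fin n → Measure ℝ) [∀ i, IsProbabilityMeasure (μ i)]
    (e : Fin m → Fin n) (he : Function.Injective e) :
    (Measure.pi μ).map (fun x i => x (e i)) = Measure.pi fun i => μ (e i) := by
  refine (Measure.pi_eq fun s hs => ?_).symm
  rw [Measure.map_apply (by fun_prop) (.univ_pi hs)]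
  classical
  have : (fun (x : Fin n → ℝ) i => x (e i)) ⁻¹' Set.univ.pi s =
      Set.univ.pi fun j => ⋂ i ∈ {i | e i = j}, s i := by
    ext x
    simp only [Set.mem_preimage, Set.mem_univ_pi, Set.mem_iInter, Set.mem_ofPred_eq]
    exact ⟨fun h j i hi => hi ▸ h i, fun h i => h _ i rfl⟩
  rw [this, Measure.pi_pi, ← Finset.prod_subset (Finset.subset_univ (Finset.univ.image e)),
    Finset.prod_image he.injOn]
  · refine Finset.prod_congr rfl fun i _ => ?_
    congr 1
    ext x
    simp [he.eq_iff]
  · intro j _ hj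
    have : ∀ i, e i ≠ j := by simpa using hj
    simp [this]

instance : IsProbabilityMeasure (expMeasure 1) := isProbabilityMeasure_expMeasure one_pos

theorem measurable_exponentialPDF (r : ℝ) : Measurable (exponentialPDF r) :=
  (measurable_exponentialPDFReal r).ennreal_ofReal

theorem expMeasure_eq_withDensity (r : ℝ) :
    expMeasure r = volume.withDensity (exponentialPDF r) := rfl

theorem lintegral_exp_mul_expMeasure {s : ℝ} (hs : s < 1) :
    ∫⁻ x, ENNReal.ofReal (Real.exp (s * x)) ∂(expMeasure 1) = ENNReal.ofReal (1 / (1 - s)) := by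
  have h1 : 0 < 1 - s := by linarith
  rw [expMeasure_eq_withDensity, lintegral_withDensity_eq_lintegral_mul _
    (measurable_exponentialPDF 1) (by fun_prop)]
  have : ∀ x, (exponentialPDF 1 * fun x => ENNReal.ofReal (Real.exp (s * x))) x =
      ENNReal.ofReal (1 / (1 - s)) * exponentialPDF (1 - s) x := by
    intro x
    simp only [Pi.mul_apply, exponentialPDF_eq]
    rw [← ENNReal.ofReal_mul' (Real.exp_pos _).le, ← ENNReal.ofReal_mul (by positivity)]
    congr 1
    split_ifs
    · rw [one_mul, ← Real.exp_add, ← mul_assoc, one_div, inv_mul_cancel₀ h1.ne', one_mul]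
      ring_nf
    · simp
  rw [lintegral_congr this, lintegral_const_mul _ (measurable_exponentialPDF _),
    lintegral_exponentialPDF_eq_one h1, mul_one]

/-- A rescaled exponential variable of rate `a / s ≥ 1` is dominated by one of rate `1`. -/
theorem map_mul_expMeasure_le {a s : ℝ} (hs : 0 < s) (hsa : s ≤ a) :
    (expMeasure a).map (fun x => s * x) ≤ ENNReal.ofReal (a / s) • expMeasure 1 := by
  refine Measure.le_iff.2 fun B hB => ?_
  have ha : 0 < a := hs.trans_le hsa
  rw [Measure.map_apply (by fun_prop) hB, Measure.smul_apply, smul_eq_mul,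
    expMeasure_eq_withDensity, expMeasure_eq_withDensity,
    withDensity_apply _ (hB.preimage (by fun_prop)), withDensity_apply _ hB,
    ← lintegral_indicator (hB.preimage (by fun_prop)), ← lintegral_indicator hB]
  have hm : Measurable (B.indicator (exponentialPDF 1)) :=
    (measurable_exponentialPDF 1).indicator hB
  have key : ∫⁻ x, B.indicator (exponentialPDF 1) (s * x) =
      ENNReal.ofReal s⁻¹ * ∫⁻ x, B.indicator (exponentialPDF 1) x := by
    rw [← lintegral_map hm (by fun_prop : Measurable fun x : ℝ => s * x),
      Real.map_volume_mul_left hs.ne', lintegral_smul_measure, abs_of_pos (by positivity),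
      smul_eq_mul]
  calc _ ≤ ∫⁻ x, ENNReal.ofReal a * B.indicator (exponentialPDF 1) (s * x) := by
        refine lintegral_mono fun x => ?_
        by_cases hB' : s * x ∈ B
        · simp only [Set.indicator, Set.mem_preimage, hB', if_true, exponentialPDF_eq]
          rw [← ENNReal.ofReal_mul ha.le]
          refine ENNReal.ofReal_le_ofReal ?_
          by_cases hx : 0 ≤ x
          · rw [if_pos hx, if_pos (by positivity)]
            rw [one_mul, one_mul]
            gcongr
          · rw [if_neg hx]
            split_ifs <;> positivity
        · simp [Set.indicator, hB']
    _ = _ := by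
      rw [lintegral_const_mul _ (show Measurable fun x => B.indicator (exponentialPDF 1) (s * x)
        from hm.comp (measurable_const_mul s)), key, ← mul_assoc,
        ← ENNReal.ofReal_mul ha.le, div_eq_mul_inv]

/-- The density of the standard Laplace distribution. -/
def laplacePDF (x : ℝ) : ℝ≥0∞ := ENNReal.ofReal (1 / 2 * Real.exp (-|x|))

@[fun_prop]
theorem measurable_laplacePDF : Measurable laplacePDF := by
  unfold laplacePDF; fun_prop

theorem laplacePDF_neg (x : ℝ) : laplacePDF (-x) = laplacePDF x := by simp [laplacePDF]

/-- A jump of a Laplace walk across the origin splits into two independent jumps. -/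
theorem laplacePDF_sub_of_nonpos_of_nonneg {x y : ℝ} (hx : x ≤ 0) (hy : 0 ≤ y) :
    laplacePDF (y - x) = 2 * (laplacePDF x * laplacePDF y) := by
  have h2 : (2 : ℝ≥0∞) = ENNReal.ofReal 2 := by simp
  rw [laplacePDF, laplacePDF, laplacePDF, ← ENNReal.ofReal_mul (by positivity), h2,
    ← ENNReal.ofReal_mul (by positivity), abs_of_nonneg (by linarith), abs_of_nonpos hx,
    abs_of_nonneg hy, show -(y - x) = - -x + -y by ring, Real.exp_add]
  congr 1
  ring

/-- The standard Laplace distribution. -/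
def laplaceMeasure : Measure ℝ := volume.withDensity laplacePDF

theorem lintegral_exponentialPDF_mul_exponentialPDF_add (d : ℝ) :
    ∫⁻ x, exponentialPDF 1 x * exponentialPDF 1 (d + x) = laplacePDF d := by
  have hm : 0 ≤ max 0 (-d) := le_max_left _ _
  have h0 : ∀ x, exponentialPDF 1 x * exponentialPDF 1 (d + x) =
      (Set.Ici (max 0 (-d))).indicator
        (fun x => ENNReal.ofReal (Real.exp (-d) * Real.exp (-2 * x))) x := by
    intro x
    simp only [exponentialPDF_eq, Set.indicator, Set.mem_Ici, max_le_iff]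
    by_cases h1 : 0 ≤ x
    · by_cases h2 : -d ≤ x
      · rw [if_pos h1, if_pos (by linarith), if_pos ⟨h1, h2⟩, ← ENNReal.ofReal_mul (by positivity)]
        simp only [one_mul, ← Real.exp_add]
        ring_nf
      · have h3 : ¬ 0 ≤ d + x := by linarith
        simp [h2, h3]
    · simp [h1]
  rw [lintegral_congr h0, lintegral_indicator measurableSet_Ici,
    setLIntegral_congr Ioi_ae_eq_Ici.symm,
    ← ofReal_integral_eq_lintegral_ofReal, integral_const_mul,
    integral_exp_mul_Ioi (by norm_num), laplacePDF]
  · congr 1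
    rcases le_total 0 d with h | h
    · rw [max_eq_left (by linarith), abs_of_nonneg h]
      simp
      ring
    · rw [max_eq_right (by linarith), abs_of_nonpos h, neg_div_neg_eq, mul_div_assoc',
        ← Real.exp_add]
      ring_nf
  · exact (integrableOn_exp_mul_Ioi (by norm_num) _).const_mul _
  · exact .of_forall fun x => by positivity

theorem map_sub_expMeasure_prod :
    ((expMeasure 1).prod (expMeasure 1)).map (fun p => p.2 - p.1) = laplaceMeasure := by
  have hpdf := measurable_exponentialPDF 1
  ext B hB
  have hind : Measurable (B.indicator (1 : ℝ → ℝ≥0∞)) := measurable_one.indicator hB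
  rw [Measure.map_apply (by fun_prop) hB, laplaceMeasure, withDensity_apply _ hB,
    expMeasure_eq_withDensity, prod_withDensity hpdf hpdf,
    withDensity_apply _ (hB.preimage (by fun_prop)),
    ← lintegral_indicator (hB.preimage (by fun_prop)), ← lintegral_indicator hB]
  have h1 : ∀ p : ℝ × ℝ, ((fun p : ℝ × ℝ => p.2 - p.1) ⁻¹' B).indicator
      (fun z => exponentialPDF 1 z.1 * exponentialPDF 1 z.2) p =
      B.indicator 1 (p.2 - p.1) * (exponentialPDF 1 p.1 * exponentialPDF 1 p.2) := by
    intro p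
    by_cases h : p.2 - p.1 ∈ B <;> simp [Set.indicator, h]
  rw [lintegral_congr h1, lintegral_prod _ (by fun_prop)]
  have h2 : ∀ x : ℝ, ∫⁻ y, B.indicator 1 (y - x) * (exponentialPDF 1 x * exponentialPDF 1 y) =
      ∫⁻ d, B.indicator 1 d * (exponentialPDF 1 x * exponentialPDF 1 (d + x)) := by
    intro x
    rw [← lintegral_add_right_eq_self _ x]
    simp
  rw [lintegral_congr h2, lintegral_lintegral_swap (by fun_prop)]
  refine lintegral_congr fun d => ?_
  rw [lintegral_const_mul _ (by fun_prop), lintegral_exponentialPDF_mul_exponentialPDF_add]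
  by_cases h : d ∈ B <;> simp [Set.indicator, h]

instance : IsProbabilityMeasure laplaceMeasure := by
  rw [← map_sub_expMeasure_prod]
  exact Measure.isProbabilityMeasure_map (by fun_prop)

theorem lintegral_exp_mul_laplaceMeasure {s : ℝ} (h1 : -1 < s) (h2 : s < 1) :
    ∫⁻ x, ENNReal.ofReal (Real.exp (s * x)) ∂laplaceMeasure = ENNReal.ofReal (1 / (1 - s ^ 2)) := by
  rw [← map_sub_expMeasure_prod, lintegral_map (by fun_prop) (by fun_prop)]
  have : ∀ p : ℝ × ℝ, ENNReal.ofReal (Real.exp (s * (p.2 - p.1))) =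
      ENNReal.ofReal (Real.exp (-s * p.1)) * ENNReal.ofReal (Real.exp (s * p.2)) := by
    intro p
    rw [← ENNReal.ofReal_mul (by positivity), ← Real.exp_add]
    ring_nf
  have h3 : 0 < 1 + s := by linarith
  have h4 : 0 < 1 - s := by linarith
  rw [lintegral_congr this, lintegral_prod_mul
      (f := fun x => ENNReal.ofReal (Real.exp (-s * x)))
      (g := fun x => ENNReal.ofReal (Real.exp (s * x))) (by fun_prop) (by fun_prop),
    lintegral_exp_mul_expMeasure (by linarith), lintegral_exp_mul_expMeasure h2,
    ← ENNReal.ofReal_mul (by rw [sub_neg_eq_add]; positivity)]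
  congr 1
  rw [sub_neg_eq_add, show 1 - s ^ 2 = (1 + s) * (1 - s) by ring]
  field_simp

/-- Extension of a tuple to a sequence by zero. -/
def zeroExt {N : ℕ} (t : Fin N → ℝ) (j : ℕ) : ℝ := if h : j < N then t ⟨j, h⟩ else 0

theorem zeroExt_of_lt {N : ℕ} (t : Fin N → ℝ) {j : ℕ} (h : j < N) : zeroExt t j = t ⟨j, h⟩ :=
  dif_pos h

theorem zeroExt_val {N : ℕ} (t : Fin N → ℝ) (i : Fin N) : zeroExt t i = t i :=
  zeroExt_of_lt t i.2

@[fun_prop]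
theorem measurable_zeroExt {N : ℕ} (j : ℕ) : Measurable fun t : Fin N → ℝ => zeroExt t j := by
  unfold zeroExt
  split_ifs
  · fun_prop
  · fun_prop

/-- The sequence of partial sums of a tuple. -/
def cumSum {N : ℕ} (d : Fin N → ℝ) : Fin N → ℝ :=
  fun i => ∑ j ∈ Finset.range (i + 1), zeroExt d j

theorem zeroExt_cumSum {N : ℕ} (d : Fin N → ℝ) {j : ℕ} (h : j < N) :
    zeroExt (cumSum d) j = ∑ i ∈ Finset.range (j + 1), zeroExt d i :=
  zeroExt_of_lt _ h

theorem measurePreserving_cumSum (N : ℕ) :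
    MeasurePreserving (cumSum : (Fin N → ℝ) → Fin N → ℝ) volume volume := by
  let M : Matrix (Fin N) (Fin N) ℝ := fun i j => if j ≤ i then 1 else 0
  have hdet : M.det = 1 := by
    rw [Matrix.det_of_isLowerTriangular M fun i j hij => if_neg (not_le.2 hij)]
    exact Finset.prod_eq_one fun i _ => if_pos le_rfl
  have hM : (cumSum : (Fin N → ℝ) → Fin N → ℝ) = Matrix.toLin' M := by
    ext d i
    rw [Matrix.toLin'_apply, Matrix.mulVec, dotProduct, cumSum]
    simp only [M, ite_mul, one_mul, zero_mul]
    calc _ = ∑ j ∈ Finset.range N, if j ≤ (i : ℕ) then zeroExt d j else 0 := by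
          rw [← Finset.sum_filter]
          refine Finset.sum_congr ?_ fun _ _ => rfl
          ext j
          simp only [Finset.mem_range, Finset.mem_filter]
          omega
      _ = _ := by
        rw [Finset.sum_range]
        simp only [zeroExt_val, Fin.le_def]
  refine ⟨by unfold cumSum; fun_prop, ?_⟩
  rw [hM, Real.map_matrix_volume_pi_eq_smul_volume_pi (by rw [hdet]; exact one_ne_zero), hdet]
  simp

/-- Tuples all of whose partial sums are positive. -/
def posPartialSums (N : ℕ) : Set (Fin N → ℝ) :=
  {t | ∀ m < N, 0 < ∑ j ∈ Finset.range (m + 1), zeroExt t j}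

theorem measurableSet_posPartialSums (N : ℕ) : MeasurableSet (posPartialSums N) := by
  have : posPartialSums N =
      ⋂ m ∈ Set.Iio N, {t | 0 < ∑ j ∈ Finset.range (m + 1), zeroExt t j} := by
    ext t
    simp [posPartialSums]
  rw [this]
  exact MeasurableSet.biInter (Set.to_countable _) fun m _ =>
    measurableSet_lt measurable_const (by fun_prop)

/-- The probability that the integrated Laplace random walk stays positive for `N` steps. -/
def persistProb (N : ℕ) : ℝ≥0∞ :=
  Measure.pi (fun _ : Fin N => laplaceMeasure) (cumSum ⁻¹' posPartialSums N)

/-- The Lebesgue density of the first `k` increments of a Laplace walk with free start. -/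
def walkDensity {N : ℕ} (k : ℕ) (t : Fin N → ℝ) : ℝ≥0∞ :=
  ∏ j ∈ Finset.range k, laplacePDF (zeroExt t (j + 1) - zeroExt t j)

@[fun_prop]
theorem measurable_walkDensity {N : ℕ} (k : ℕ) :
    Measurable (walkDensity k : (Fin N → ℝ) → ℝ≥0∞) := by
  unfold walkDensity
  fun_prop

theorem walkDensity_cumSum {k : ℕ} (d : Fin (k + 1) → ℝ) :
    walkDensity k (cumSum d) = ∏ i : Fin k, laplacePDF (d i.succ) := by
  rw [walkDensity, Finset.prod_range]
  refine Finset.prod_congr rfl fun i _ => ?_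
  rw [zeroExt_cumSum d (by omega), zeroExt_cumSum d (by omega), Finset.sum_range_succ,
    add_sub_cancel_left]
  exact congrArg laplacePDF (zeroExt_val d i.succ)

theorem pi_laplaceMeasure (N : ℕ) :
    Measure.pi (fun _ : Fin N => laplaceMeasure) =
      volume.withDensity fun d => ∏ i, laplacePDF (d i) := by
  have : SigmaFinite (volume.withDensity laplacePDF) :=
    inferInstanceAs (SigmaFinite laplaceMeasure)
  exact pi_withDensity_eq (fun _ => volume) (fun _ => laplacePDF) fun _ => measurable_laplacePDF

theorem persistProb_succ (k : ℕ) :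
    persistProb (k + 1) =
      ∫⁻ t in posPartialSums (k + 1), laplacePDF (zeroExt t 0) * walkDensity k t := by
  have hc := measurePreserving_cumSum (k + 1)
  have hS := measurableSet_posPartialSums (k + 1)
  rw [persistProb, pi_laplaceMeasure, withDensity_apply _ (hS.preimage hc.measurable),
    ← hc.setLIntegral_comp_preimage hS (by fun_prop)]
  refine lintegral_congr fun d => ?_
  rw [walkDensity_cumSum, zeroExt_cumSum d (by omega), Fin.prod_univ_succ]
  congr 2
  simp [zeroExt]

/-- Splitting a tuple into two blocks, the first one being reversed and negated. -/
def splitNegRev (k l : ℕ) (t : Fin (k + l) → ℝ) : (Fin k → ℝ) × (Fin l → ℝ) :=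
  (fun i => -t (Fin.castAdd l i.rev), fun j => t (Fin.natAdd k j))

theorem measurePreserving_splitNegRev (k l : ℕ) :
    MeasurePreserving (splitNegRev k l) volume (volume.prod volume) := by
  let e : Fin k ⊕ Fin l ≃ Fin (k + l) :=
    (Equiv.sumCongr Fin.revPerm (Equiv.refl _)).trans finSumFinEquiv
  have h1 := (volume_measurePreserving_piCongrLeft (fun _ => ℝ) e).symm
  have h2 := volume_measurePreserving_sumPiEquivProdPi fun _ : Fin k ⊕ Fin l => ℝ
  have h3 := (Measure.measurePreserving_neg (volume : Measure (Fin k → ℝ))).prod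
    (MeasurePreserving.id (volume : Measure (Fin l → ℝ)))
  exact h3.comp (h2.comp h1)

theorem zeroExt_splitNegRev_fst {k l : ℕ} (t : Fin (k + l) → ℝ) {j : ℕ} (h : j < k) :
    zeroExt (splitNegRev k l t).1 j = -zeroExt t (k - 1 - j) := by
  rw [zeroExt_of_lt _ h, zeroExt_of_lt _ (by omega), splitNegRev]
  refine congrArg Neg.neg (congrArg t (Fin.ext ?_))
  simp
  omega

theorem zeroExt_splitNegRev_snd {k l : ℕ} (t : Fin (k + l) → ℝ) {j : ℕ} (h : j < l) :
    zeroExt (splitNegRev k l t).2 j = zeroExt t (k + j) := by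
  rw [zeroExt_of_lt _ h, zeroExt_of_lt _ (by omega), splitNegRev]
  rfl

/-- Paths whose integral has its unique minimum at time `k`. -/
def minAt (N k : ℕ) : Set (Fin N → ℝ) :=
  {t | (∀ m < k, ∑ j ∈ Finset.range (m + 1), zeroExt t (k - 1 - j) < 0) ∧
    ∀ m < N - k, 0 < ∑ j ∈ Finset.range (m + 1), zeroExt t (k + j)}

theorem minAt_eq_preimage (k l : ℕ) :
    minAt (k + l) k = splitNegRev k l ⁻¹' (posPartialSums k ×ˢ posPartialSums l) := by
  ext t
  rw [Set.mem_preimage, Set.mem_prod]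
  refine and_congr (forall₂_congr fun m hm => ?_) ?_
  · rw [Finset.sum_congr rfl fun j hj => zeroExt_splitNegRev_fst t
      (show j < k by have := Finset.mem_range.1 hj; omega), Finset.sum_neg_distrib]
    exact neg_pos.symm
  · rw [add_tsub_cancel_left]
    refine forall₂_congr fun m hm => ?_
    rw [Finset.sum_congr rfl fun j hj => zeroExt_splitNegRev_snd t
      (show j < l by have := Finset.mem_range.1 hj; omega)]

theorem measurableSet_minAt {N k : ℕ} (h : k ≤ N) : MeasurableSet (minAt N k) := by
  obtain ⟨l, rfl⟩ := Nat.exists_eq_add_of_le h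
  rw [minAt_eq_preimage]
  exact ((measurableSet_posPartialSums k).prod (measurableSet_posPartialSums l)).preimage
    (measurePreserving_splitNegRev k l).measurable

/-- At the minimum of the integrated walk, the two sides are independent persistent walks. -/
theorem lintegral_minAt (k l : ℕ) :
    ∫⁻ t in minAt (k + 1 + (l + 1)) (k + 1), walkDensity (k + 1 + l) t =
      2 * (persistProb (k + 1) * persistProb (l + 1)) := by
  have hs := measurePreserving_splitNegRev (k + 1) (l + 1)
  have hm := (measurableSet_posPartialSums (k + 1)).prod (measurableSet_posPartialSums (l + 1))
  let F (n : ℕ) (a : Fin (n + 1) → ℝ) : ℝ≥0∞ := laplacePDF (zeroExt a 0) * walkDensity n a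
  have hF : ∀ n, Measurable (F n) := fun n => by fun_prop
  have key : ∀ t ∈ minAt (k + 1 + (l + 1)) (k + 1), walkDensity (k + 1 + l) t =
      2 * (F k (splitNegRev (k + 1) (l + 1) t).1 * F l (splitNegRev (k + 1) (l + 1) t).2) := by
    intro t ht
    have h1 : zeroExt t k < 0 := by simpa using ht.1 0 (by omega)
    have h2 : 0 < zeroExt t (k + 1) := by simpa using ht.2 0 (by omega)
    have ha : walkDensity k (splitNegRev (k + 1) (l + 1) t).1 =
        ∏ j ∈ Finset.range k, laplacePDF (zeroExt t (j + 1) - zeroExt t j) := by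
      rw [walkDensity, ← Finset.prod_range_reflect]
      refine Finset.prod_congr rfl fun j hj => ?_
      have hj := Finset.mem_range.1 hj
      rw [zeroExt_splitNegRev_fst t (by omega), zeroExt_splitNegRev_fst t (by omega),
        neg_sub_neg]
      congr 3 <;> omega
    have hb : walkDensity l (splitNegRev (k + 1) (l + 1) t).2 =
        ∏ j ∈ Finset.range l,
          laplacePDF (zeroExt t (k + 1 + j + 1) - zeroExt t (k + 1 + j)) := by
      refine Finset.prod_congr rfl fun j hj => ?_
      have hj := Finset.mem_range.1 hj
      rw [zeroExt_splitNegRev_snd t (by omega), zeroExt_splitNegRev_snd t (by omega)]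
      rfl
    simp only [F]
    rw [ha, hb, zeroExt_splitNegRev_fst t (by omega), zeroExt_splitNegRev_snd t (by omega),
      walkDensity, Finset.prod_range_add, Finset.prod_range_succ,
      laplacePDF_sub_of_nonpos_of_nonneg h1.le h2.le, laplacePDF_neg]
    simp only [add_tsub_cancel_right, tsub_zero, add_zero]
    ring
  rw [setLIntegral_congr_fun (measurableSet_minAt (by omega)) key, minAt_eq_preimage,
    hs.setLIntegral_comp_preimage (f := fun p => 2 * (F k p.1 * F l p.2)) hm (by fun_prop),
    ← Measure.prod_restrict, lintegral_const_mul _ (by fun_prop),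
    lintegral_prod_mul (by fun_prop) (by fun_prop), persistProb_succ, persistProb_succ]

theorem zeroExt_comp_castLE {M N : ℕ} (h : M ≤ N) (d : Fin N → ℝ) {j : ℕ} (hj : j < M) :
    zeroExt (fun i => d (Fin.castLE h i)) j = zeroExt d j := by
  rw [zeroExt_of_lt _ hj, zeroExt_of_lt _ (hj.trans_le h)]
  rfl

theorem zeroExt_cons_succ {N : ℕ} (x : ℝ) (d : Fin N → ℝ) (j : ℕ) :
    zeroExt (Fin.cons x d : Fin (N + 1) → ℝ) (j + 1) = zeroExt d j := by
  by_cases h : j < N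
  · rw [zeroExt_of_lt _ h, zeroExt_of_lt _ (by omega)]
    exact Fin.cons_succ (α := fun _ => ℝ) x d ⟨j, h⟩
  · rw [zeroExt, zeroExt, dif_neg h, dif_neg (by omega)]

theorem zeroExt_cons_zero {N : ℕ} (x : ℝ) (d : Fin N → ℝ) :
    zeroExt (Fin.cons x d : Fin (N + 1) → ℝ) 0 = x := by
  simp [zeroExt]

theorem zeroExt_neg {N : ℕ} (d : Fin N → ℝ) (j : ℕ) : zeroExt (-d) j = -zeroExt d j := by
  unfold zeroExt
  split_ifs <;> simp

theorem persistProb_le_one (N : ℕ) : persistProb N ≤ 1 := prob_le_one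

theorem persistProb_anti {M N : ℕ} (h : M ≤ N) : persistProb N ≤ persistProb M := by
  rw [persistProb, persistProb,
    ← map_pi_comp_injective (fun _ : Fin N => laplaceMeasure) (Fin.castLE h)
      (Fin.castLE_injective h), Measure.map_apply (by fun_prop)
      ((measurableSet_posPartialSums M).preimage (measurePreserving_cumSum M).measurable)]
  refine measure_mono fun d hd m hm => ?_
  have := hd m (hm.trans_le h)
  refine this.trans_eq (Finset.sum_congr rfl fun j hj => ?_)
  have hj := Finset.mem_range.1 hj
  rw [zeroExt_cumSum d (by omega), zeroExt_cumSum _ (by omega)]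
  refine Finset.sum_congr rfl fun i hi => ?_
  have hi := Finset.mem_range.1 hi
  exact (zeroExt_comp_castLE h d (by omega)).symm

theorem disjoint_minAt {N k l : ℕ} (hkl : k < l) (hl : l ≤ N) :
    Disjoint (minAt N k) (minAt N l) := by
  refine Set.disjoint_left.2 fun t hk hl' => ?_
  have h1 := hk.2 (l - k - 1) (by omega)
  have h2 := hl'.1 (l - k - 1) (by omega)
  rw [← Finset.sum_range_reflect] at h1
  refine lt_asymm (h1.trans_eq (Finset.sum_congr rfl fun j hj => ?_)) h2
  have hj := Finset.mem_range.1 hj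
  congr 1
  omega

/-- Paths started from `x` which visit the positive half-line. -/
def hitPos (N : ℕ) (x : ℝ) : Set (Fin N → ℝ) :=
  {d | ∃ j ≤ N, 0 < x + ∑ i ∈ Finset.range j, zeroExt d i}

theorem measurableSet_hitPos_prod (N : ℕ) :
    MeasurableSet {p : ℝ × (Fin N → ℝ) | p.2 ∈ hitPos N p.1} := by
  have : {p : ℝ × (Fin N → ℝ) | p.2 ∈ hitPos N p.1} =
      ⋃ j ∈ Set.Iic N, {p | 0 < p.1 + ∑ i ∈ Finset.range j, zeroExt p.2 i} := by
    ext t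
    simp [hitPos]
  rw [this]
  refine MeasurableSet.biUnion (Set.to_countable _) fun m _ =>
    measurableSet_lt measurable_const (measurable_fst.add (Finset.measurable_sum _ fun j _ => ?_))
  exact (measurable_zeroExt j).comp measurable_snd

theorem cons_mem_hitPos {N : ℕ} {x : ℝ} (hx : x ≤ 0) (y : ℝ) (d : Fin N → ℝ) :
    (Fin.cons y d : Fin (N + 1) → ℝ) ∈ hitPos (N + 1) x ↔ d ∈ hitPos N (x + y) := by
  have key : ∀ j, ∑ i ∈ Finset.range (j + 1), zeroExt (Fin.cons y d : Fin (N + 1) → ℝ) i =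
      y + ∑ i ∈ Finset.range j, zeroExt d i := fun j => by
    rw [Finset.sum_range_succ', add_comm, zeroExt_cons_zero]
    simp only [zeroExt_cons_succ]
  constructor
  · rintro ⟨j, hj, h⟩
    obtain _ | j := j
    · simp at h
      linarith
    · rw [key] at h
      exact ⟨j, by omega, by linarith⟩
  · rintro ⟨j, hj, h⟩
    exact ⟨j + 1, by omega, by rw [key]; linarith⟩

/-- Ville's inequality for the exponential supermartingale of the Laplace walk. -/
theorem pi_laplaceMeasure_hitPos_le {s : ℝ} (h0 : 0 < s) (h1 : s < 1) (N : ℕ) (x : ℝ) :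
    Measure.pi (fun _ : Fin N => laplaceMeasure) (hitPos N x) ≤
      ENNReal.ofReal (1 / (1 - s ^ 2)) ^ N * ENNReal.ofReal (Real.exp (s * x)) := by
  have hs : 0 < 1 - s ^ 2 := by nlinarith
  have hc : 1 ≤ ENNReal.ofReal (1 / (1 - s ^ 2)) := by
    rw [ENNReal.one_le_ofReal, le_div_iff₀ hs]
    nlinarith
  induction N generalizing x with
  | zero =>
    rcases le_or_gt x 0 with hx | hx
    · have : hitPos 0 x = ∅ := by
        ext d
        simp [hitPos, hx]
      simp [this]
    · refine prob_le_one.trans ?_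
      rw [pow_zero, one_mul, ENNReal.one_le_ofReal]
      exact Real.one_le_exp (by positivity)
  | succ N ih =>
    rcases le_or_gt x 0 with hx | hx
    · have hm := measurableSet_hitPos_prod N
      have hpre : (MeasurableEquiv.piFinSuccAbove (fun _ : Fin (N + 1) => ℝ) 0).symm ⁻¹'
          hitPos (N + 1) x = {p | p.2 ∈ hitPos N (x + p.1)} := by
        ext p
        rw [Set.mem_preimage, Set.mem_ofPred_eq, ← cons_mem_hitPos hx]
        simp [MeasurableEquiv.piFinSuccAbove, Fin.insertNthEquiv]
      have hm' : MeasurableSet {p : ℝ × (Fin N → ℝ) | p.2 ∈ hitPos N (x + p.1)} :=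
        hm.preimage (f := fun p : ℝ × (Fin N → ℝ) => (x + p.1, p.2)) (by fun_prop)
      rw [← (measurePreserving_piFinSuccAbove (fun _ : Fin (N + 1) => laplaceMeasure)
        0).symm.measure_preimage_equiv, hpre, Measure.prod_apply hm']
      calc _ ≤ ∫⁻ y, ENNReal.ofReal (1 / (1 - s ^ 2)) ^ N * ENNReal.ofReal (Real.exp (s * x)) *
            ENNReal.ofReal (Real.exp (s * y)) ∂laplaceMeasure := by
            refine lintegral_mono fun y => (ih (x + y)).trans_eq ?_
            rw [mul_add, Real.exp_add, ENNReal.ofReal_mul (by positivity), mul_assoc]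
        _ = _ := by
          rw [lintegral_const_mul _ (by fun_prop),
            lintegral_exp_mul_laplaceMeasure (by linarith) h1, pow_succ]
          ring
    · refine prob_le_one.trans ?_
      refine one_le_mul (one_le_pow₀ hc) ?_
      rw [ENNReal.one_le_ofReal]
      exact Real.one_le_exp (by positivity)

theorem walkDensity_neg {N : ℕ} (k : ℕ) (t : Fin N → ℝ) : walkDensity k (-t) = walkDensity k t := by
  refine Finset.prod_congr rfl fun j _ => ?_
  rw [zeroExt_neg, zeroExt_neg, ← laplacePDF_neg]
  congr 1
  ring

/-- Paths starting from a nonpositive value and reaching a positive one. -/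
def upcrossing (N : ℕ) : Set (Fin N → ℝ) :=
  {t | zeroExt t 0 ≤ 0 ∧ ∃ j < N, 0 < zeroExt t j}

theorem measurableSet_upcrossing (N : ℕ) : MeasurableSet (upcrossing N) := by
  have : upcrossing N = {t | zeroExt t 0 ≤ 0} ∩ ⋃ j ∈ Set.Iio N, {t | 0 < zeroExt t j} := by
    ext t
    simp [upcrossing]
  rw [this]
  exact (measurableSet_le (by fun_prop) measurable_const).inter
    (MeasurableSet.biUnion (Set.to_countable _) fun m _ =>
      measurableSet_lt measurable_const (by fun_prop))

theorem cumSum_cons_mem_upcrossing {N : ℕ} (x : ℝ) (d : Fin N → ℝ) :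
    cumSum (Fin.cons x d : Fin (N + 1) → ℝ) ∈ upcrossing (N + 1) ↔ x ≤ 0 ∧ d ∈ hitPos N x := by
  have key : ∀ j < N + 1, zeroExt (cumSum (Fin.cons x d : Fin (N + 1) → ℝ)) j =
      x + ∑ i ∈ Finset.range j, zeroExt d i := fun j hj => by
    rw [zeroExt_cumSum _ hj, Finset.sum_range_succ', add_comm, zeroExt_cons_zero]
    simp only [zeroExt_cons_succ]
  refine and_congr (by rw [key 0 (by omega)]; simp) (exists_congr fun j => ?_)
  rw [Nat.lt_succ_iff]
  exact and_congr_right fun hj => by rw [key j (by omega)]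

theorem lintegral_upcrossing_le {s : ℝ} (h0 : 0 < s) (h1 : s < 1) (N : ℕ) :
    ∫⁻ t in upcrossing (N + 1), walkDensity N t ≤
      ENNReal.ofReal (1 / (1 - s ^ 2)) ^ N * ENNReal.ofReal (1 / s) := by
  have hc := measurePreserving_cumSum (N + 1)
  have hU := measurableSet_upcrossing (N + 1)
  have hH := measurableSet_hitPos_prod N
  have he := (volume_preserving_piFinSuccAbove (fun _ : Fin (N + 1) => ℝ) 0).symm
  have hslice : ∀ x, MeasurableSet (hitPos N x) := fun x =>
    hH.preimage (f := fun d : Fin N → ℝ => (x, d)) (by fun_prop)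
  have hS : MeasurableSet {p : ℝ × (Fin N → ℝ) | p.1 ≤ 0 ∧ p.2 ∈ hitPos N p.1} :=
    (measurableSet_le measurable_fst measurable_const).inter hH
  have hpre : (MeasurableEquiv.piFinSuccAbove (fun _ : Fin (N + 1) => ℝ) 0).symm ⁻¹'
      (cumSum ⁻¹' upcrossing (N + 1)) = {p | p.1 ≤ 0 ∧ p.2 ∈ hitPos N p.1} := by
    ext p
    rw [Set.mem_preimage, Set.mem_ofPred_eq, ← cumSum_cons_mem_upcrossing]
    simp [MeasurableEquiv.piFinSuccAbove, Fin.insertNthEquiv]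
  have hdens : ∀ p, walkDensity N (cumSum
      ((MeasurableEquiv.piFinSuccAbove (fun _ : Fin (N + 1) => ℝ) 0).symm p)) =
      ∏ i, laplacePDF (p.2 i) := fun p => by
    rw [walkDensity_cumSum]
    simp [MeasurableEquiv.piFinSuccAbove, Fin.insertNthEquiv]
  rw [← hc.setLIntegral_comp_preimage hU (by fun_prop),
    ← he.setLIntegral_comp_preimage_emb (MeasurableEquiv.measurableEmbedding _), hpre]
  simp only [hdens]
  rw [← lintegral_indicator hS, Measure.volume_eq_prod,
    lintegral_prod _ (Measurable.aemeasurable (Measurable.indicator (by fun_prop) hS))]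
  calc _ ≤ ∫⁻ x, (Set.Iic 0).indicator (fun x => ENNReal.ofReal (1 / (1 - s ^ 2)) ^ N *
        ENNReal.ofReal (Real.exp (s * x))) x := by
        refine lintegral_mono fun x => ?_
        rcases le_or_gt x 0 with hx | hx
        · rw [Set.indicator_of_mem (show x ∈ Set.Iic 0 from hx)]
          refine le_trans (le_of_eq ?_) (pi_laplaceMeasure_hitPos_le h0 h1 N x)
          rw [pi_laplaceMeasure, withDensity_apply _ (hslice x), ← lintegral_indicator (hslice x)]
          refine lintegral_congr fun d => ?_
          by_cases hd : d ∈ hitPos N x <;> simp [Set.indicator, hd, hx]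
        · simp [Set.indicator, hx.not_ge]
    _ = _ := by
      rw [lintegral_indicator measurableSet_Iic, lintegral_const_mul _ (by fun_prop),
        ← ofReal_integral_eq_lintegral_ofReal (integrableOn_exp_mul_Iic h0 _)
          (.of_forall fun x => by positivity), integral_exp_mul_Iic h0]
      simp

theorem mul_persistProb_sq_le {s : ℝ} (h0 : 0 < s) (h1 : s < 1) (n : ℕ) :
    (n + 1) * (persistProb (n + 2) * persistProb (n + 2)) ≤
      ENNReal.ofReal (1 / (1 - s ^ 2)) ^ (n + 1) * ENNReal.ofReal (1 / s) := by
  have hle : ∀ j ∈ Finset.range (n + 1), 2 * (persistProb (n + 2) * persistProb (n + 2)) ≤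
      ∫⁻ t in minAt (n + 2) (j + 1), walkDensity (n + 1) t := fun j hj => by
    have hj := Finset.mem_range.1 hj
    obtain ⟨l, rfl⟩ := Nat.exists_eq_add_of_le (Nat.lt_succ_iff.1 hj)
    have := lintegral_minAt j l
    rw [show j + 1 + (l + 1) = j + l + 2 by ring, show j + 1 + l = j + l + 1 by ring] at this
    rw [this]
    gcongr <;> exact persistProb_anti (by omega)
  have hdisj : Set.PairwiseDisjoint (Finset.range (n + 1) : Set ℕ)
      fun j => minAt (n + 2) (j + 1) := fun i hi j hj hij => by
    have hi := Finset.mem_range.1 hi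
    have hj := Finset.mem_range.1 hj
    rcases lt_or_gt_of_ne hij with h | h
    · exact disjoint_minAt (by omega) (by omega)
    · exact (disjoint_minAt (by omega) (by omega)).symm
  have hsub : ⋃ j ∈ Finset.range (n + 1), minAt (n + 2) (j + 1) ⊆
      upcrossing (n + 2) ∪ Neg.neg ⁻¹' upcrossing (n + 2) := by
    refine Set.iUnion₂_subset fun j hj t ht => ?_
    have hj := Finset.mem_range.1 hj
    have h1 : zeroExt t j < 0 := by simpa using ht.1 0 (by omega)
    have h2 : 0 < zeroExt t (j + 1) := by simpa using ht.2 0 (by omega)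
    rcases le_total (zeroExt t 0) 0 with h | h
    · exact Or.inl ⟨h, j + 1, by omega, h2⟩
    · exact Or.inr ⟨by rw [zeroExt_neg]; linarith, j, by omega, by rw [zeroExt_neg]; linarith⟩
  have hneg : ∫⁻ t in Neg.neg ⁻¹' upcrossing (n + 2), walkDensity (n + 1) t =
      ∫⁻ t in upcrossing (n + 2), walkDensity (n + 1) t := by
    rw [← (Measure.measurePreserving_neg (volume : Measure (Fin (n + 2) → ℝ))
      ).setLIntegral_comp_preimage (measurableSet_upcrossing _) (by fun_prop)]
    simp only [walkDensity_neg]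
  have := calc
    2 * ((n + 1) * (persistProb (n + 2) * persistProb (n + 2))) =
        ∑ j ∈ Finset.range (n + 1), 2 * (persistProb (n + 2) * persistProb (n + 2)) := by
      rw [Finset.sum_const, Finset.card_range, nsmul_eq_mul]
      push_cast
      ring
    _ ≤ ∑ j ∈ Finset.range (n + 1), ∫⁻ t in minAt (n + 2) (j + 1), walkDensity (n + 1) t :=
      Finset.sum_le_sum hle
    _ = ∫⁻ t in ⋃ j ∈ Finset.range (n + 1), minAt (n + 2) (j + 1), walkDensity (n + 1) t :=
      (lintegral_biUnion_finset hdisj (fun j hj => measurableSet_minAt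
        (by have := Finset.mem_range.1 hj; omega)) _).symm
    _ ≤ ∫⁻ t in upcrossing (n + 2) ∪ Neg.neg ⁻¹' upcrossing (n + 2), walkDensity (n + 1) t :=
      lintegral_mono_set hsub
    _ ≤ _ := lintegral_union_le _ _ _
    _ = 2 * ∫⁻ t in upcrossing (n + 2), walkDensity (n + 1) t := by rw [hneg, two_mul]
    _ ≤ _ := mul_le_mul_right (lintegral_upcrossing_le h0 h1 (n + 1)) 2
  exact (ENNReal.mul_le_mul_iff_right (by simp) (by simp)).1 this

theorem persistProb_le {N : ℕ} (hN : 1 ≤ N) :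
    persistProb N ≤ ENNReal.ofReal (3 * (N : ℝ) ^ (-(1 / 4) : ℝ)) := by
  obtain _ | _ | n := N
  · omega
  · refine (persistProb_le_one _).trans ?_
    simp
  set N := n + 1 + 1 with hNdef
  have hN2 : (2 : ℝ) ≤ N := by exact_mod_cast (by omega : 2 ≤ N)
  have hn : ((n + 1 : ℕ) : ℝ) = N - 1 := by rw [hNdef]; push_cast; ring
  have hsq : √(N : ℝ) ^ 2 = N := Real.sq_sqrt (by linarith)
  have hs1 : 1 < √(N : ℝ) := Real.lt_sqrt_of_sq_lt (by linarith)
  have h := mul_persistProb_sq_le (s := 1 / √(N : ℝ)) (by positivity)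
    ((div_lt_one (by linarith)).2 hs1) n
  have hfin : persistProb N ≠ ∞ := (persistProb_le_one N).trans_lt ENNReal.one_lt_top |>.ne
  set q := (persistProb N).toReal with hq
  have hqp : persistProb N = ENNReal.ofReal q := (ENNReal.ofReal_toReal hfin).symm
  have hq0 : 0 ≤ q := ENNReal.toReal_nonneg
  have hbase : 1 / (1 - (1 / √(N : ℝ)) ^ 2) = 1 + 1 / (N - 1 : ℝ) := by
    rw [div_pow, hsq]
    have : (N : ℝ) - 1 ≠ 0 := by linarith
    field_simp
    ring
  have hexp : (1 + 1 / (N - 1 : ℝ)) ^ (n + 1) ≤ Real.exp 1 := by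
    have h1 : 0 < (N : ℝ) - 1 := by linarith
    calc (1 + 1 / (N - 1 : ℝ)) ^ (n + 1) ≤ Real.exp (1 / (N - 1 : ℝ)) ^ (n + 1) := by
          gcongr
          linarith [Real.add_one_le_exp (1 / (N - 1 : ℝ))]
      _ = Real.exp 1 := by
        rw [← Real.exp_nat_mul, hn]
        congr 1
        field_simp
  have hreal : (N - 1 : ℝ) * (q * q) ≤ 3 * √(N : ℝ) := by
    have hcast : ((n : ℝ≥0∞) + 1) = ENNReal.ofReal (N - 1 : ℝ) := by
      rw [← hn, ENNReal.ofReal_natCast]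
      push_cast
      ring
    have hpos : 0 ≤ 1 + 1 / (N - 1 : ℝ) := by
      have : 0 < (N : ℝ) - 1 := by linarith
      positivity
    rw [show n + 2 = N from rfl, hqp, hcast, hbase, ← ENNReal.ofReal_mul hq0,
      ← ENNReal.ofReal_mul (by linarith), ← ENNReal.ofReal_pow hpos,
      ← ENNReal.ofReal_mul (by positivity), ENNReal.ofReal_le_ofReal_iff (by positivity)] at h
    refine h.trans ?_
    rw [one_div_one_div]
    gcongr
    linarith [Real.exp_one_lt_d9]
  rw [hqp]
  refine ENNReal.ofReal_le_ofReal ?_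
  have hr : ((N : ℝ) ^ (-(1 / 4) : ℝ)) ^ 2 * √(N : ℝ) = 1 := by
    rw [← Real.rpow_natCast, ← Real.rpow_mul (by positivity), Real.sqrt_eq_rpow,
      ← Real.rpow_add (by linarith)]
    norm_num
  set r := (N : ℝ) ^ (-(1 / 4) : ℝ)
  have hr0 : 0 < r := by positivity
  refine abs_le_of_sq_le_sq' ?_ (by positivity) |>.2
  have h2 : q * q * √(N : ℝ) ≤ 6 := by
    have h3 : (N : ℝ) / 2 * (q * q) ≤ 3 * √(N : ℝ) := by
      refine le_trans ?_ hreal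
      gcongr
      linarith
    rw [← hsq] at h3
    nlinarith
  nlinarith

theorem lintegral_exp_mul_sum {n : ℕ} {s : ℝ} (hs : s < 1) :
    ∫⁻ x, ENNReal.ofReal (Real.exp (s * ∑ i, x i)) ∂(Measure.pi fun _ : Fin n => expMeasure 1) =
      ENNReal.ofReal (1 / (1 - s)) ^ n := by
  have : ∀ x : Fin n → ℝ, ENNReal.ofReal (Real.exp (s * ∑ i, x i)) =
      ∏ i, ENNReal.ofReal (Real.exp (s * x i)) := fun x => by
    rw [Finset.mul_sum, Real.exp_sum, ENNReal.ofReal_prod_of_nonneg fun i _ => (Real.exp_pos _).le]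
  rw [lintegral_congr this, lintegral_pi_prod_eq_prod (fun _ => expMeasure 1)
    (fun _ x => ENNReal.ofReal (Real.exp (s * x))) fun _ => by fun_prop]
  simp [lintegral_exp_mul_expMeasure hs]

/-- A Chernoff bound for the comparison of two independent sums of exponential variables. -/
theorem prod_pi_expMeasure_sum_le {n : ℕ} (hn : 1 ≤ n) {δ : ℝ} (h0 : 0 < δ) (h1 : δ ≤ 1) :
    ((Measure.pi fun _ : Fin n => expMeasure 1).prod (Measure.pi fun _ : Fin n => expMeasure 1))
      {p | (1 + δ) * ∑ i, p.2 i ≤ ∑ i, p.1 i} ≤ ENNReal.ofReal (8 / (n * δ ^ 2)) := by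
  set μ := Measure.pi fun _ : Fin n => expMeasure 1
  have hn' : (0 : ℝ) < n := by exact_mod_cast hn
  have hexp : ∀ p : (Fin n → ℝ) × (Fin n → ℝ),
      {p : (Fin n → ℝ) × (Fin n → ℝ) | (1 + δ) * ∑ i, p.2 i ≤ ∑ i, p.1 i}.indicator 1 p ≤
      ENNReal.ofReal (Real.exp (δ / 4 * ∑ i, p.1 i)) *
        ENNReal.ofReal (Real.exp (-(δ / 4 * (1 + δ)) * ∑ i, p.2 i)) := fun p => by
    refine Set.indicator_apply_le' (fun hp => ?_) fun _ => bot_le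
    rw [← ENNReal.ofReal_mul (by positivity), ← Real.exp_add, Pi.one_apply,
      ENNReal.one_le_ofReal]
    refine Real.one_le_exp ?_
    have : (1 + δ) * ∑ i, p.2 i ≤ ∑ i, p.1 i := hp
    nlinarith
  have hms : MeasurableSet {p : (Fin n → ℝ) × (Fin n → ℝ) | (1 + δ) * ∑ i, p.2 i ≤ ∑ i, p.1 i} :=
    measurableSet_le (by fun_prop) (by fun_prop)
  rw [← lintegral_indicator_one hms]
  refine (lintegral_mono hexp).trans ?_
  rw [lintegral_prod_mul (f := fun x : Fin n → ℝ => ENNReal.ofReal (Real.exp (δ / 4 * ∑ i, x i)))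
    (g := fun x : Fin n → ℝ => ENNReal.ofReal (Real.exp (-(δ / 4 * (1 + δ)) * ∑ i, x i)))
    (by fun_prop) (by fun_prop), lintegral_exp_mul_sum (by linarith),
    lintegral_exp_mul_sum (by nlinarith), ← mul_pow]
  have h2 : 0 < 1 - δ / 4 := by linarith
  have h3 : 0 < 1 - -(δ / 4 * (1 + δ)) := by nlinarith
  rw [← ENNReal.ofReal_mul (by positivity), ← ENNReal.ofReal_pow (by positivity)]
  refine ENNReal.ofReal_le_ofReal ?_
  have hb : 1 + n * (δ ^ 2 / 8) ≤ (1 + δ ^ 2 / 8) ^ n :=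
    one_add_mul_le_pow (by nlinarith [sq_nonneg δ]) n
  have hle : 1 + δ ^ 2 / 8 ≤ (1 - δ / 4) * (1 - -(δ / 4 * (1 + δ))) := by
    nlinarith [mul_nonneg (sq_nonneg δ) (sub_nonneg.2 h1)]
  calc _ = 1 / ((1 - δ / 4) * (1 - -(δ / 4 * (1 + δ)))) ^ n := by
        rw [div_mul_div_comm, one_mul, div_pow, one_pow]
    _ ≤ 1 / (n * (δ ^ 2 / 8)) := by
        gcongr
        linarith [pow_le_pow_left₀ (by positivity) hle n]
    _ = _ := by field_simp

theorem sum_range_sum_range_succ (n : ℕ) (f : ℕ → ℝ) :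
    ∑ i ∈ Finset.range n, ∑ j ∈ Finset.range (i + 1), f j =
      ∑ j ∈ Finset.range n, ((n : ℝ) - j) * f j := by
  induction n with
  | zero => simp
  | succ n ih =>
    rw [Finset.sum_range_succ, ih, Finset.sum_range_succ, Finset.sum_range_succ, ← add_assoc,
      ← Finset.sum_add_distrib]
    push_cast
    congr 1
    · exact Finset.sum_congr rfl fun j _ => by ring
    · ring

theorem prod_sub_eq_factorial (n : ℕ) : ∏ i : Fin n, ((n : ℝ) - i) = n.factorial := by
  rw [← Finset.prod_range_add_one_eq_factorial, ← Finset.prod_range_reflect,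
    Finset.prod_range (fun j => n - 1 - j + 1), Nat.cast_prod]
  refine Finset.prod_congr rfl fun i _ => ?_
  rw [show n - 1 - (i : ℕ) + 1 = n - i by omega, Nat.cast_sub i.2.le]

/-- Nonnegative increasing tuples. -/
def monoCone (n : ℕ) : Set (Fin n → ℝ) := {x | Monotone x ∧ ∀ i, 0 ≤ x i}

theorem measurableSet_monotone (n : ℕ) : MeasurableSet {x : Fin n → ℝ | Monotone x} := by
  have : {x : Fin n → ℝ | Monotone x} =
      ⋂ (i : Fin n) (j : Fin n) (_ : i ≤ j), {x | x i ≤ x j} := by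
    ext x
    simp [Monotone]
  rw [this]
  exact .iInter fun i => .iInter fun j => .iInter fun _ =>
    measurableSet_le (by fun_prop) (by fun_prop)

theorem measurableSet_monoCone (n : ℕ) : MeasurableSet (monoCone n) := by
  have : monoCone n = {x | Monotone x} ∩ ⋂ i, {x | 0 ≤ x i} := by
    ext x
    simp [monoCone]
  rw [this]
  refine (measurableSet_monotone n).inter ?_
  exact .iInter fun i => measurableSet_le (by fun_prop) (by fun_prop)

theorem nonneg_of_cumSum_mem_monoCone {n : ℕ} {g : Fin n → ℝ} (h : cumSum g ∈ monoCone n)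
    (i : Fin n) : 0 ≤ g i := by
  obtain ⟨i, hi⟩ := i
  rw [← zeroExt_of_lt g hi]
  obtain _ | i := i
  · simpa [cumSum] using h.2 ⟨0, hi⟩
  · have := h.1 (show (⟨i, by omega⟩ : Fin n) ≤ ⟨i + 1, hi⟩ from Nat.le_succ i)
    rw [cumSum, cumSum, Finset.sum_range_succ _ (i + 1)] at this
    simpa using this

instance {n : ℕ} (i : Fin n) : IsProbabilityMeasure (expMeasure ((n : ℝ) - i)) :=
  isProbabilityMeasure_expMeasure (sub_pos.2 (by exact_mod_cast i.2))

/-- The law of the gaps between consecutive order statistics of i.i.d. exponential variables. -/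
def gapMeasure (n : ℕ) : Measure (Fin n → ℝ) := Measure.pi fun i => expMeasure ((n : ℝ) - i)

instance (n : ℕ) : IsProbabilityMeasure (gapMeasure n) :=
  inferInstanceAs (IsProbabilityMeasure (Measure.pi _))

theorem prod_exponentialPDF_gap {n : ℕ} {g : Fin n → ℝ} (h : cumSum g ∈ monoCone n) :
    ∏ i : Fin n, exponentialPDF ((n : ℝ) - i) (g i) =
      n.factorial * ∏ i, exponentialPDF 1 (cumSum g i) := by
  have h1 : ∀ i : Fin n, exponentialPDF ((n : ℝ) - i) (g i) =
      ENNReal.ofReal (((n : ℝ) - i) * Real.exp (-(((n : ℝ) - i) * g i))) := fun i => by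
    rw [exponentialPDF_eq, if_pos (nonneg_of_cumSum_mem_monoCone h i)]
  have h2 : ∀ i : Fin n, exponentialPDF 1 (cumSum g i) =
      ENNReal.ofReal (Real.exp (-cumSum g i)) := fun i => by
    rw [exponentialPDF_eq, if_pos (h.2 i), one_mul, one_mul]
  have hpos : ∀ i : Fin n, 0 ≤ (n : ℝ) - i := fun i => sub_nonneg.2 (by exact_mod_cast i.2.le)
  simp only [h1, h2]
  rw [← ENNReal.ofReal_prod_of_nonneg fun i _ => mul_nonneg (hpos i) (Real.exp_pos _).le,
    ← ENNReal.ofReal_prod_of_nonneg fun i _ => (Real.exp_pos _).le, Finset.prod_mul_distrib,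
    prod_sub_eq_factorial, ENNReal.ofReal_mul (by positivity), ENNReal.ofReal_natCast,
    ← Real.exp_sum, ← Real.exp_sum, Finset.sum_neg_distrib, Finset.sum_neg_distrib]
  congr 4
  have := sum_range_sum_range_succ n (zeroExt g)
  rw [Finset.sum_range, Finset.sum_range] at this
  simp only [zeroExt_val] at this
  exact this.symm

/-- Rényi's representation of the order statistics of i.i.d. exponential variables. -/
theorem factorial_smul_restrict_monoCone_le (n : ℕ) :
    (n.factorial : ℝ≥0∞) • (Measure.pi fun _ : Fin n => expMeasure 1).restrict (monoCone n) ≤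
      (gapMeasure n).map cumSum := by
  have hc := measurePreserving_cumSum n
  have hsf : ∀ (r : ℝ) [IsProbabilityMeasure (expMeasure r)],
      SigmaFinite (volume.withDensity (exponentialPDF r)) := fun r _ =>
    inferInstanceAs (SigmaFinite (expMeasure r))
  have h1 : (Measure.pi fun _ : Fin n => expMeasure 1) =
      volume.withDensity fun x => ∏ i, exponentialPDF 1 (x i) := by
    have := hsf 1
    exact pi_withDensity_eq (fun _ => volume) (fun _ => exponentialPDF 1)
      fun _ => measurable_exponentialPDF 1
  have h2 : gapMeasure n =
      volume.withDensity fun x => ∏ i : Fin n, exponentialPDF ((n : ℝ) - i) (x i) := by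
    have := fun i : Fin n => hsf ((n : ℝ) - i)
    exact pi_withDensity_eq (fun _ => volume) (fun i : Fin n => exponentialPDF ((n : ℝ) - i))
      fun i => measurable_exponentialPDF _
  have hpdf := measurable_exponentialPDF 1
  refine Measure.le_iff.2 fun B hB => ?_
  have hBC := hB.inter (measurableSet_monoCone n)
  rw [Measure.smul_apply, Measure.restrict_apply hB, Measure.map_apply hc.measurable hB, h1, h2,
    withDensity_apply _ hBC, withDensity_apply _ (hB.preimage hc.measurable), smul_eq_mul,
    ← lintegral_const_mul _ (by fun_prop),
    ← hc.setLIntegral_comp_preimage hBC (by fun_prop)]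
  refine le_trans (le_of_eq ?_) (lintegral_mono_set (Set.preimage_mono
    (Set.inter_subset_left (t := monoCone n))))
  exact setLIntegral_congr_fun (hBC.preimage hc.measurable) fun g hg =>
    (prod_exponentialPDF_gap hg.2).symm

theorem cumSum_sub {N : ℕ} (a b : Fin N → ℝ) : cumSum (b - a) = cumSum b - cumSum a := by
  ext i
  simp only [cumSum, Pi.sub_apply]
  rw [← Finset.sum_sub_distrib]
  refine Finset.sum_congr rfl fun j _ => ?_
  unfold zeroExt
  split_ifs <;> simp

theorem map_sub_pi_expMeasure_prod (M : ℕ) :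
    ((Measure.pi fun _ : Fin M => expMeasure 1).prod (Measure.pi fun _ : Fin M => expMeasure 1)).map
      (fun p => p.2 - p.1) = Measure.pi fun _ => laplaceMeasure := by
  rw [← (measurePreserving_arrowProdEquivProdArrow ℝ ℝ (Fin M) (fun _ => expMeasure 1)
    fun _ => expMeasure 1).map_eq, Measure.map_map (by fun_prop) (MeasurableEquiv.measurable _)]
  have hsf : SigmaFinite (((expMeasure 1).prod (expMeasure 1)).map fun p : ℝ × ℝ => p.2 - p.1) := by
    rw [map_sub_expMeasure_prod]
    infer_instance
  simp only [← map_sub_expMeasure_prod]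
  rw [← Measure.pi_map_pi (fun _ => by fun_prop)]
  rfl

/-- Initial segments of rescaled gaps are dominated by i.i.d. exponential variables. -/
theorem map_gapMeasure_le {M n : ℕ} (h : M ≤ n) {s : ℝ} (h0 : 0 < s) (hs : s ≤ (n : ℝ) - M) :
    (gapMeasure n).map (fun g (i : Fin M) => s * g (Fin.castLE h i)) ≤
      ENNReal.ofReal (n / s) ^ M • Measure.pi fun _ : Fin M => expMeasure 1 := by
  have hcast : ∀ i : Fin M, (i : ℝ) ≤ M := fun i => by exact_mod_cast i.2.le
  have hp : ∀ i : Fin M, IsProbabilityMeasure ((expMeasure ((n : ℝ) - (Fin.castLE h i : Fin n))).map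
      fun x => s * x) := fun i => Measure.isProbabilityMeasure_map (by fun_prop)
  have : (gapMeasure n).map (fun g (i : Fin M) => s * g (Fin.castLE h i)) =
      Measure.pi fun i : Fin M =>
        (expMeasure ((n : ℝ) - (Fin.castLE h i : Fin n))).map (fun x => s * x) := by
    rw [← Measure.pi_map_pi (fun _ => by fun_prop), ← map_pi_comp_injective
      (fun i : Fin n => expMeasure ((n : ℝ) - i)) _ (Fin.castLE_injective h),
      Measure.map_map (by fun_prop) (by fun_prop)]
    rfl
  rw [this]
  refine pi_le_smul_pi _ _ _ fun i => ?_
  refine (map_mul_expMeasure_le h0 (hs.trans ?_)).trans ?_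
  · rw [Fin.val_castLE]
    linarith [hcast i]
  · refine Measure.le_iff.2 fun B _ => ?_
    rw [Measure.smul_apply, Measure.smul_apply, smul_eq_mul, smul_eq_mul]
    gcongr
    simp

/-- Pairs of tuples, with all partial sums of the first one below those of the second one. -/
def ltPartialSums (n M : ℕ) (c : ℝ) : Set ((Fin n → ℝ) × (Fin n → ℝ)) :=
  {p | ∀ m < M, ∑ l ∈ Finset.range (m + 1), zeroExt p.1 l <
    c * ∑ l ∈ Finset.range (m + 1), zeroExt p.2 l}

theorem measurableSet_ltPartialSums (n M : ℕ) (c : ℝ) : MeasurableSet (ltPartialSums n M c) := by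
  have : ltPartialSums n M c =
      ⋂ m ∈ Set.Iio M, {p | ∑ l ∈ Finset.range (m + 1), zeroExt p.1 l <
        c * ∑ l ∈ Finset.range (m + 1), zeroExt p.2 l} := by
    ext t
    simp [ltPartialSums]
  rw [this]
  refine MeasurableSet.biInter (Set.to_countable _) fun m _ => measurableSet_lt
    (Finset.measurable_sum _ fun j _ => (measurable_zeroExt j).comp measurable_fst)
    ((Finset.measurable_sum _ fun j _ => (measurable_zeroExt j).comp measurable_snd).const_mul c)

theorem measurable_cumSum {n : ℕ} : Measurable (cumSum : (Fin n → ℝ) → Fin n → ℝ) :=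
  (measurePreserving_cumSum n).measurable

theorem prod_pi_expMeasure_cumSum_lt (M : ℕ) :
    ((Measure.pi fun _ : Fin M => expMeasure 1).prod (Measure.pi fun _ : Fin M => expMeasure 1))
      (Prod.map cumSum cumSum ⁻¹' ltPartialSums M M 1) = persistProb M := by
  rw [persistProb, ← map_sub_pi_expMeasure_prod, Measure.map_apply (by fun_prop)
    ((measurableSet_posPartialSums M).preimage measurable_cumSum)]
  congr 1
  ext p
  refine forall₂_congr fun m hm => ?_
  rw [cumSum_sub, one_mul, ← sub_pos, ← Finset.sum_sub_distrib]
  simp only [zeroExt, Prod.map_fst, Prod.map_snd, Pi.sub_apply]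
  refine iff_of_eq (congrArg (0 < ·) (Finset.sum_congr rfl fun j _ => ?_))
  split_ifs <;> simp

theorem cumSum_mul_castLE {M n : ℕ} (h : M ≤ n) (s : ℝ) (g : Fin n → ℝ) {j : ℕ} (hj : j < M) :
    zeroExt (cumSum fun i : Fin M => s * g (Fin.castLE h i)) j = s * zeroExt (cumSum g) j := by
  rw [zeroExt_cumSum _ hj, zeroExt_cumSum _ (hj.trans_le h), Finset.mul_sum]
  refine Finset.sum_congr rfl fun i hi => ?_
  have hi := Finset.mem_range.1 hi
  rw [zeroExt_of_lt _ (by omega), zeroExt_of_lt _ (by omega)]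
  rfl

theorem gapMeasure_prod_ltPartialSums_le {M n : ℕ} (h : M ≤ n) {s c : ℝ} (h0 : 0 < s) (hc : 1 ≤ c)
    (hs : s * c ≤ (n : ℝ) - M) :
    ((gapMeasure n).prod (gapMeasure n)) (Prod.map cumSum cumSum ⁻¹' ltPartialSums n M c) ≤
      ENNReal.ofReal (n / s) ^ M * ENNReal.ofReal (n / (s * c)) ^ M * persistProb M := by
  have hsc : s ≤ s * c := le_mul_of_one_le_right h0.le hc
  let A (r : ℝ) (g : Fin n → ℝ) (i : Fin M) : ℝ := r * g (Fin.castLE h i)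
  have hA : ∀ r, Measurable (A r) := fun r => by fun_prop
  have hpre : Prod.map cumSum cumSum ⁻¹' ltPartialSums n M c = Prod.map (A s) (A (s * c)) ⁻¹'
      (Prod.map cumSum cumSum ⁻¹' ltPartialSums M M 1) := by
    ext p
    refine forall₂_congr fun m hm => ?_
    have key : ∀ (r : ℝ) (g : Fin n → ℝ), ∑ l ∈ Finset.range (m + 1), zeroExt (cumSum (A r g)) l =
        r * ∑ l ∈ Finset.range (m + 1), zeroExt (cumSum g) l := fun r g => by
      rw [Finset.mul_sum]
      exact Finset.sum_congr rfl fun l hl =>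
        cumSum_mul_castLE h r g (by have := Finset.mem_range.1 hl; omega)
    simp only [Prod.map_fst, Prod.map_snd, key, one_mul]
    rw [mul_assoc, mul_lt_mul_iff_right₀ h0]
  have hmeas := (measurableSet_ltPartialSums M M 1).preimage
    ((measurable_cumSum (n := M)).prodMap (measurable_cumSum (n := M)))
  rw [hpre, ← Measure.map_apply ((hA _).prodMap (hA _)) hmeas,
    ← Measure.map_prod_map _ _ (hA _) (hA _)]
  refine (Measure.prod_mono (map_gapMeasure_le h h0 (hsc.trans hs))
    (map_gapMeasure_le h (by positivity) hs) _).trans_eq ?_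
  rw [Measure.prod_smul_left, Measure.prod_smul_right, smul_smul, Measure.smul_apply,
    prod_pi_expMeasure_cumSum_lt, smul_eq_mul]

theorem factorial_sq_mul_ltPartialSums_le {M n : ℕ} (h : M ≤ n) {s c : ℝ} (h0 : 0 < s) (hc : 1 ≤ c)
    (hs : s * c ≤ (n : ℝ) - M) :
    (n.factorial * n.factorial : ℝ≥0∞) *
      ((Measure.pi fun _ : Fin n => expMeasure 1).prod (Measure.pi fun _ : Fin n => expMeasure 1))
        ((monoCone n ×ˢ monoCone n) ∩ ltPartialSums n M c) ≤
      ENNReal.ofReal (n / s) ^ M * ENNReal.ofReal (n / (s * c)) ^ M * persistProb M := by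
  have hm := measurableSet_ltPartialSums n M c
  refine le_trans ?_ (gapMeasure_prod_ltPartialSums_le h h0 hc hs)
  rw [← Measure.map_apply (measurable_cumSum.prodMap measurable_cumSum) hm,
    ← Measure.map_prod_map _ _ measurable_cumSum measurable_cumSum]
  refine le_trans (le_of_eq ?_) (Measure.prod_mono (factorial_smul_restrict_monoCone_le n)
    (factorial_smul_restrict_monoCone_le n) _)
  rw [Measure.prod_smul_left, Measure.prod_smul_right, smul_smul, Measure.smul_apply,
    Measure.prod_restrict, Measure.restrict_apply hm, Set.inter_comm, smul_eq_mul]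

theorem tailSum_sortDesc {n : ℕ} (v : Fin n → ℝ) {m : ℕ} (hm : m < n) :
    tailSum (sortDesc v) ⟨n - 1 - m, by omega⟩ =
      ∑ l ∈ Finset.range (m + 1), zeroExt (v ∘ Tuple.sort v) l := by
  rw [tailSum, Finset.sum_filter, ← Equiv.sum_comp Fin.revPerm]
  have h1 : Finset.range (m + 1) = (Finset.range n).filter (· ≤ m) := by
    ext j
    simp only [Finset.mem_range, Finset.mem_filter]
    omega
  rw [h1, Finset.sum_filter, Finset.sum_range]
  refine Finset.sum_congr rfl fun i _ => ?_
  rw [zeroExt_val]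
  refine if_congr ?_ ?_ rfl
  · rw [Fin.le_def, Fin.revPerm_apply, Fin.val_rev]
    have := i.2
    simp only
    omega
  · simp [sortDesc]

theorem ae_pos_pi_expMeasure (n : ℕ) :
    ∀ᵐ Z ∂(Measure.pi fun _ : Fin n => expMeasure 1), ∀ i, 0 < Z i := by
  rw [ae_all_iff]
  intro i
  have h : ∀ᵐ x ∂(expMeasure 1), 0 < x := by
    rw [ae_iff, expMeasure_eq_withDensity]
    have : {x : ℝ | ¬ 0 < x} = Set.Iic 0 := by
      ext x
      simp
    rw [this, withDensity_apply _ measurableSet_Iic, setLIntegral_congr Iio_ae_eq_Iic.symm]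
    exact lintegral_exponentialPDF_of_nonpos le_rfl
  exact (Measure.quasiMeasurePreserving_eval (fun _ : Fin n => expMeasure 1) i).ae h

/-- Pairs which, after reordering both tuples increasingly, have comparable initial sums. -/
def sortedLePartialSums (n M : ℕ) : Set ((Fin n → ℝ) × (Fin n → ℝ)) :=
  ⋃ (σ : Equiv.Perm (Fin n)) (τ : Equiv.Perm (Fin n)),
    {p | Monotone (p.1 ∘ σ) ∧ Monotone (p.2 ∘ τ) ∧ ∀ m < M,
      ∑ l ∈ Finset.range (m + 1), zeroExt (p.1 ∘ σ) l ≤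
        ∑ l ∈ Finset.range (m + 1), zeroExt (p.2 ∘ τ) l}

theorem measurable_comp_perm {n : ℕ} (σ : Equiv.Perm (Fin n)) :
    Measurable fun x : Fin n → ℝ => x ∘ σ :=
  measurable_pi_lambda _ fun _ => measurable_pi_apply _

theorem measurableSet_sortedLePartialSums (n M : ℕ) :
    MeasurableSet (sortedLePartialSums n M) := by
  refine .iUnion fun σ => .iUnion fun τ => ?_
  have h1 : Measurable fun p : (Fin n → ℝ) × (Fin n → ℝ) => p.1 ∘ σ :=
    (measurable_comp_perm σ).comp measurable_fst
  have h2 : Measurable fun p : (Fin n → ℝ) × (Fin n → ℝ) => p.2 ∘ τ :=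
    (measurable_comp_perm τ).comp measurable_snd
  refine ((measurableSet_monotone n).preimage h1).inter
    (((measurableSet_monotone n).preimage h2).inter ?_)
  have : {p : (Fin n → ℝ) × (Fin n → ℝ) | ∀ m < M,
      ∑ l ∈ Finset.range (m + 1), zeroExt (p.1 ∘ σ) l ≤
        ∑ l ∈ Finset.range (m + 1), zeroExt (p.2 ∘ τ) l} =
      ⋂ m ∈ Set.Iio M, {p | ∑ l ∈ Finset.range (m + 1), zeroExt (p.1 ∘ σ) l ≤
        ∑ l ∈ Finset.range (m + 1), zeroExt (p.2 ∘ τ) l} := by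
    ext t
    simp
  exact this.symm.subst (motive := MeasurableSet)
    (MeasurableSet.biInter (Set.to_countable _) fun m _ => measurableSet_le
    (Finset.measurable_sum _ fun j _ => (measurable_zeroExt j).comp h1)
    (Finset.measurable_sum _ fun j _ => (measurable_zeroExt j).comp h2))

theorem setOf_tailSum_le_subset {n M : ℕ} (h : M ≤ n) :
    {p : (Fin n → ℝ) × (Fin n → ℝ) | ∀ k, tailSum (sortDesc p.1) k ≤ tailSum (sortDesc p.2) k} ⊆
      sortedLePartialSums n M := fun p hp =>
  Set.mem_iUnion₂.2 ⟨Tuple.sort p.1, Tuple.sort p.2, Tuple.monotone_sort _, Tuple.monotone_sort _,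
    fun m hm => by
      rw [← tailSum_sortDesc _ (hm.trans_le h), ← tailSum_sortDesc _ (hm.trans_le h)]
      exact hp _⟩

theorem measurePreserving_comp_perm {n : ℕ} (σ : Equiv.Perm (Fin n)) :
    MeasurePreserving (fun x : Fin n → ℝ => x ∘ σ) (Measure.pi fun _ => expMeasure 1)
      (Measure.pi fun _ => expMeasure 1) :=
  ⟨measurable_comp_perm σ, map_pi_comp_injective (fun _ => expMeasure 1) σ σ.injective⟩

theorem div_sum_comp_mem_ltPartialSums {n M : ℕ} {Z W : Fin n → ℝ} {c : ℝ}
    (hM : M ≤ n) (hZ : ∀ i, 0 < Z i) (hW : ∀ i, 0 < W i) (hlt : ∑ i, Z i < c * ∑ i, W i)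
    (σ τ : Equiv.Perm (Fin n)) (h1 : Monotone ((fun i => Z i / ∑ j, Z j) ∘ σ))
    (h2 : Monotone ((fun i => W i / ∑ j, W j) ∘ τ))
    (hle : ∀ m < M, ∑ l ∈ Finset.range (m + 1), zeroExt ((fun i => Z i / ∑ j, Z j) ∘ σ) l ≤
        ∑ l ∈ Finset.range (m + 1), zeroExt ((fun i => W i / ∑ j, W j) ∘ τ) l) :
    (Z ∘ σ, W ∘ τ) ∈ (monoCone n ×ˢ monoCone n) ∩ ltPartialSums n M c := by
  rcases n.eq_zero_or_pos with rfl | hn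
  · simp at hlt
  have hne : (Finset.univ : Finset (Fin n)).Nonempty := ⟨⟨0, hn⟩, Finset.mem_univ _⟩
  have hSZ : 0 < ∑ i, Z i := Finset.sum_pos (fun i _ => hZ i) hne
  have hSW : 0 < ∑ i, W i := Finset.sum_pos (fun i _ => hW i) hne
  have key : ∀ (Y : Fin n → ℝ) (ρ : Equiv.Perm (Fin n)) (m : ℕ),
      ∑ l ∈ Finset.range m, zeroExt ((fun i => Y i / ∑ j, Y j) ∘ ρ) l =
        (∑ l ∈ Finset.range m, zeroExt (Y ∘ ρ) l) / ∑ j, Y j := fun Y ρ m => by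
    rw [Finset.sum_div]
    refine Finset.sum_congr rfl fun l _ => ?_
    unfold zeroExt
    split_ifs <;> simp
  refine ⟨⟨⟨fun i j hij => ?_, fun i => (hZ _).le⟩, fun i j hij => ?_, fun i => (hW _).le⟩,
    fun m hm => ?_⟩
  · exact (div_le_div_iff_of_pos_right hSZ).1 (h1 hij)
  · exact (div_le_div_iff_of_pos_right hSW).1 (h2 hij)
  · have h := hle m hm
    rw [key, key, div_le_div_iff₀ hSZ hSW] at h
    have hB : 0 < ∑ l ∈ Finset.range (m + 1), zeroExt (W ∘ τ) l := by
      refine Finset.sum_pos (fun l hl => ?_) (by simp)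
      have hl := Finset.mem_range.1 hl
      rw [zeroExt_of_lt _ (by omega)]
      exact hW _
    have h3 := mul_lt_mul_of_pos_left hlt hB
    refine lt_of_mul_lt_mul_right (h.trans_lt (h3.trans_eq ?_)) hSW.le
    ring

/-- Comparing simplex vectors reduces to comparing ordered exponential vectors. -/
theorem prod_simplexUniform_le {n M : ℕ} (h : M ≤ n) (c : ℝ) :
    ((simplexUniform n).prod (simplexUniform n))
        {p | ∀ k : Fin n, tailSum (sortDesc p.1) k ≤ tailSum (sortDesc p.2) k} ≤
      ((Measure.pi fun _ : Fin n => expMeasure 1).prod (Measure.pi fun _ : Fin n => expMeasure 1))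
        {p | c * ∑ i, p.2 i ≤ ∑ i, p.1 i} +
      (n.factorial * n.factorial : ℝ≥0∞) *
        ((Measure.pi fun _ : Fin n => expMeasure 1).prod (Measure.pi fun _ : Fin n => expMeasure 1))
          ((monoCone n ×ˢ monoCone n) ∩ ltPartialSums n M c) := by
  set μ := Measure.pi fun _ : Fin n => expMeasure 1 with hμ
  set B := (monoCone n ×ˢ monoCone n) ∩ ltPartialSums n M c with hB
  have hBm : MeasurableSet B :=
    ((measurableSet_monoCone n).prod (measurableSet_monoCone n)).inter
      (measurableSet_ltPartialSums n M c)
  have hq : Measurable fun (Z : Fin n → ℝ) i => Z i / ∑ j, Z j := by fun_prop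
  have hpos : ∀ᵐ p ∂(μ.prod μ), (∀ i, 0 < p.1 i) ∧ ∀ i, 0 < p.2 i :=
    (Measure.quasiMeasurePreserving_fst.ae (ae_pos_pi_expMeasure n)).and
      (Measure.quasiMeasurePreserving_snd.ae (ae_pos_pi_expMeasure n))
  let T (σ τ : Equiv.Perm (Fin n)) (p : (Fin n → ℝ) × (Fin n → ℝ)) := (p.1 ∘ σ, p.2 ∘ τ)
  have hT : ∀ σ τ, (μ.prod μ) (T σ τ ⁻¹' B) = (μ.prod μ) B := fun σ τ =>
    ((measurePreserving_comp_perm σ).prod (measurePreserving_comp_perm τ)).measure_preimage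
      hBm.nullMeasurableSet
  refine (measure_mono (setOf_tailSum_le_subset h)).trans ?_
  rw [simplexUniform, Measure.map_prod_map _ _ hq hq, Measure.map_apply (hq.prodMap hq)
    (measurableSet_sortedLePartialSums n M), ← hμ]
  calc _ ≤ (μ.prod μ) ({p | c * ∑ i, p.2 i ≤ ∑ i, p.1 i} ∪ ⋃ σ, ⋃ τ, T σ τ ⁻¹' B) := by
        refine measure_mono_ae (hpos.mono fun p hp hpE => ?_)
        obtain ⟨σ, τ, h1, h2, h3⟩ := Set.mem_iUnion₂.1 hpE
        rcases le_or_gt (c * ∑ i, p.2 i) (∑ i, p.1 i) with hc | hc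
        · exact Or.inl hc
        · exact Or.inr (Set.mem_iUnion₂.2 ⟨σ, τ,
            div_sum_comp_mem_ltPartialSums h hp.1 hp.2 hc σ τ h1 h2 h3⟩)
    _ ≤ (μ.prod μ) {p | c * ∑ i, p.2 i ≤ ∑ i, p.1 i} +
        ∑ σ, ∑ τ, (μ.prod μ) (T σ τ ⁻¹' B) := by
      refine (measure_union_le _ _).trans ?_
      gcongr
      refine (measure_iUnion_fintype_le _ _).trans (Finset.sum_le_sum fun σ _ => ?_)
      exact measure_iUnion_fintype_le _ _
    _ = _ := by
      simp only [hT, Finset.sum_const, Finset.card_univ, Fintype.card_perm, Fintype.card_fin,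
        nsmul_eq_mul, mul_assoc]

theorem exists_pow_four_le {n : ℕ} (hn : 1 ≤ n) : ∃ M : ℕ, 1 ≤ M ∧ M ^ 4 ≤ n ∧ n < (2 * M) ^ 4 := by
  refine ⟨n.sqrt.sqrt, Nat.sqrt_pos.2 (Nat.sqrt_pos.2 hn), ?_, ?_⟩
  · calc n.sqrt.sqrt ^ 4 = (n.sqrt.sqrt ^ 2) ^ 2 := by ring
      _ ≤ n.sqrt ^ 2 := Nat.pow_le_pow_left (Nat.sqrt_le' _) 2
      _ ≤ n := Nat.sqrt_le' n
  · have h1 : 1 ≤ n.sqrt.sqrt := Nat.sqrt_pos.2 (Nat.sqrt_pos.2 hn)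
    have h2 : n.sqrt + 1 ≤ (n.sqrt.sqrt + 1) ^ 2 := Nat.lt_succ_sqrt' _
    calc n < (n.sqrt + 1) ^ 2 := Nat.lt_succ_sqrt' n
      _ ≤ ((n.sqrt.sqrt + 1) ^ 2) ^ 2 := Nat.pow_le_pow_left h2 2
      _ = (n.sqrt.sqrt + 1) ^ 4 := by ring
      _ ≤ _ := Nat.pow_le_pow_left (by omega) 4

theorem gap_constant_le {M n : ℕ} (hM : 1 ≤ M) (hn : 2 ≤ n) (h : M ^ 4 ≤ n) :
    ((n : ℝ) / (((n : ℝ) - M) / (1 + 1 / M))) ^ M * ((n : ℝ) / ((n : ℝ) - M)) ^ M ≤ Real.exp 5 := by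
  have hM' : (1 : ℝ) ≤ M := by exact_mod_cast hM
  have hn' : (2 : ℝ) ≤ n := by exact_mod_cast hn
  have h' : (M : ℝ) ^ 4 ≤ n := by exact_mod_cast h
  have hMsq : (M : ℝ) ^ 2 ≤ n := (pow_le_pow_right₀ hM' (by norm_num)).trans h'
  have h2M : 2 * (M : ℝ) ≤ n := by
    rcases hM.eq_or_lt with rfl | hM2
    · simpa using hn'
    · have : (2 : ℝ) ≤ M := by exact_mod_cast hM2
      nlinarith
  have hpos : 0 < (n : ℝ) - M := by linarith
  have hc : 1 + 1 / (M : ℝ) ≤ Real.exp (1 / M) := by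
    linarith [Real.add_one_le_exp (1 / (M : ℝ))]
  have hr : (n : ℝ) / (n - M) ≤ Real.exp (M / (n - M)) := by
    have := Real.add_one_le_exp ((M : ℝ) / (n - M))
    refine le_trans (le_of_eq ?_) this
    field_simp
    ring
  have hfrac : (M : ℝ) * (M / (n - M)) ≤ 2 := by
    rw [mul_div_assoc', div_le_iff₀ hpos]
    nlinarith
  calc _ = (1 + 1 / (M : ℝ)) ^ M * ((n : ℝ) / (n - M)) ^ M * ((n : ℝ) / (n - M)) ^ M := by
        rw [div_div_eq_mul_div, mul_div_right_comm, mul_pow]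
        ring
    _ ≤ Real.exp (1 / M) ^ M * Real.exp (M / (n - M)) ^ M * Real.exp (M / (n - M)) ^ M := by
      gcongr
    _ ≤ _ := by
      rw [← Real.exp_nat_mul, ← Real.exp_nat_mul, ← Real.exp_add, ← Real.exp_add]
      refine Real.exp_le_exp.2 ?_
      rw [mul_one_div_cancel (by positivity)]
      linarith

theorem prod_simplexUniform_le_rpow {n : ℕ} (hn : 2 ≤ n) :
    ((simplexUniform n).prod (simplexUniform n))
        {p | ∀ k : Fin n, tailSum (sortDesc p.1) k ≤ tailSum (sortDesc p.2) k} ≤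
      ENNReal.ofReal ((8 + 6 * Real.exp 5) * (n : ℝ) ^ (-(1 / 16) : ℝ)) := by
  obtain ⟨M, hM, hMn, hnM⟩ := exists_pow_four_le (show 1 ≤ n by omega)
  have hM' : (1 : ℝ) ≤ M := by exact_mod_cast hM
  have hn' : (2 : ℝ) ≤ n := by exact_mod_cast hn
  have h4 : (M : ℝ) ^ 4 ≤ n := by exact_mod_cast hMn
  have hlt : M < n := by
    rcases hM.eq_or_lt with rfl | hM2
    · omega
    · exact (lt_self_pow₀ hM2 (by norm_num)).trans_le hMn
  have hpos : 0 < (n : ℝ) - M := sub_pos.2 (by exact_mod_cast hlt)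
  set c : ℝ := 1 + 1 / M with hc
  have hc1 : 1 ≤ c := by
    rw [hc]
    linarith [one_div_pos.2 (show 0 < (M : ℝ) by linarith)]
  have hc0 : 0 < c := by linarith
  set r := (n : ℝ) ^ (-(1 / 16) : ℝ) with hr
  have hr0 : 0 < r := by positivity
  have hscale : ((n : ℝ) - M) / c * c = n - M := div_mul_cancel₀ _ hc0.ne'
  have hfirst : ((Measure.pi fun _ : Fin n => expMeasure 1).prod
      (Measure.pi fun _ : Fin n => expMeasure 1)) {p | c * ∑ i, p.2 i ≤ ∑ i, p.1 i} ≤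
      ENNReal.ofReal (8 * r) := by
    refine (prod_pi_expMeasure_sum_le (by omega) (by positivity)
      ((div_le_one (by linarith)).2 hM')).trans (ENNReal.ofReal_le_ofReal ?_)
    have hsq : (M : ℝ) ^ 2 ≤ √n := Real.le_sqrt_of_sq_le (by rw [← pow_mul]; exact h4)
    have hsn : (√n)⁻¹ ≤ r := by
      rw [Real.sqrt_eq_rpow, ← Real.rpow_neg (by positivity), hr]
      exact Real.rpow_le_rpow_of_exponent_le (by linarith) (by norm_num)
    calc 8 / (n * (1 / (M : ℝ)) ^ 2) = 8 * ((M : ℝ) ^ 2 / n) := by field_simp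
      _ ≤ 8 * (√n / n) := by gcongr
      _ = 8 * (√n)⁻¹ := by rw [Real.sqrt_div_self]
      _ ≤ 8 * r := by gcongr
  have hpersist : persistProb M ≤ ENNReal.ofReal (6 * r) := by
    refine (persistProb_le hM).trans (ENNReal.ofReal_le_ofReal ?_)
    have h2M : (n : ℝ) ≤ (2 * M) ^ 4 := by exact_mod_cast hnM.le
    have hr2 : (2 * (M : ℝ)) ^ (-(1 / 4) : ℝ) ≤ r := by
      have := Real.rpow_le_rpow_of_nonpos (by positivity) h2M
        (show (-(1 / 16) : ℝ) ≤ 0 by norm_num)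
      refine le_trans (le_of_eq ?_) this
      rw [← Real.rpow_natCast, ← Real.rpow_mul (by positivity)]
      norm_num
    have h2 : (1 / 2 : ℝ) ≤ 2 ^ (-(1 / 4) : ℝ) := by
      rw [one_div, ← Real.rpow_neg_one]
      exact Real.rpow_le_rpow_of_exponent_le (by norm_num) (by norm_num)
    rw [Real.mul_rpow (by norm_num) (by positivity)] at hr2
    have hMr : 0 < (M : ℝ) ^ (-(1 / 4) : ℝ) := by positivity
    nlinarith
  have hsecond := factorial_sq_mul_ltPartialSums_le hlt.le (div_pos hpos hc0) hc1 hscale.le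
  rw [hscale, ← ENNReal.ofReal_pow (by positivity), ← ENNReal.ofReal_pow (by positivity),
    ← ENNReal.ofReal_mul (by positivity)] at hsecond
  refine (prod_simplexUniform_le hlt.le c).trans ((add_le_add hfirst (hsecond.trans
    (mul_le_mul' (ENNReal.ofReal_le_ofReal (gap_constant_le hM hn hMn)) hpersist))).trans_eq ?_)
  rw [← ENNReal.ofReal_mul (by positivity), ← ENNReal.ofReal_add (by positivity) (by positivity)]
  congr 1
  ring

theorem rpow_le_div_log_rpow {n : ℕ} (hn : 2 ≤ n) :
    (n : ℝ) ^ (-(1 / 16) : ℝ) ≤ 2 * ((n : ℝ) / Real.log n) ^ (-(1 / 16) : ℝ) := by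
  have hn' : (2 : ℝ) ≤ n := by exact_mod_cast hn
  have hlog : 1 / 2 ≤ Real.log n :=
    (by linarith [Real.log_two_gt_d9] : 1 / 2 ≤ Real.log 2).trans
      (Real.log_le_log (by norm_num) hn')
  have hpow : (1 / 2 : ℝ) ≤ Real.log n ^ (1 / 16 : ℝ) :=
    calc (1 / 2 : ℝ) = (1 / 2) ^ (1 : ℝ) := (Real.rpow_one _).symm
      _ ≤ (1 / 2) ^ (1 / 16 : ℝ) :=
        Real.rpow_le_rpow_of_exponent_ge (by norm_num) (by norm_num) (by norm_num)
      _ ≤ _ := by gcongr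
  rw [Real.div_rpow (by positivity) (by linarith), Real.rpow_neg (by linarith : 0 ≤ Real.log n),
    div_inv_eq_mul]
  have : 0 < (n : ℝ) ^ (-(1 / 16) : ℝ) := by positivity
  nlinarith

/-- Theorem 2 of the paper: for two independent uniform random points of the simplex
`Δ_{n−1}`, the probability that (the decreasing rearrangement of) one majorises the other is
at most `C (n / log n)^{-1/16}`. -/
theorem uniform_simplex_majorisation :
    ∃ C : ℝ, ∀ n : ℕ, 2 ≤ n →
      ((simplexUniform n).prod (simplexUniform n))
          {p | ∀ k : Fin n, tailSum (sortDesc p.1) k ≤ tailSum (sortDesc p.2) k}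
        ≤ ENNReal.ofReal (C * ((n : ℝ) / Real.log n) ^ (-(1/16) : ℝ)) := by
  refine ⟨(8 + 6 * Real.exp 5) * 2, fun n hn => (prod_simplexUniform_le_rpow hn).trans
    (ENNReal.ofReal_le_ofReal ?_)⟩
  rw [mul_assoc]
  exact mul_le_mul_of_nonneg_left (rpow_le_div_log_rpow hn) (by positivity)
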